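/- Let F = {f_1,…,f_N} be a post-critically finite IFS of bi-Lipschitz contractions on a complete metric space (X,d) with attractor K, satisfying the single intersection condition and the angle separation condition. Suppose A_i·d(x,y) ≤ d(f_i(x),f_i(y)) ≤ B_i·d(x,y) for all x,y ∈ X with 0 < A_i ≤ B_i < 1, and set A_* = min_i A_i and B^* = max_i B_i. Then there exist constants c_1, c_2 > 0 such that for all x ≠ y in Σ_K, letting n be the least positive integer with f_{x_1⋯x_n}(K) ∩ f_{y_1⋯y_n}(K) = ∅ (such n exists), one has c_1·(A_*)^n ≤ d(π_K(x), π_K(y)) ≤ c_2·(B^*)^n. -/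

import Mathlib

open Set Metric
open scoped ENNReal

/-- `wordMap f [i₁,…,i_k] = f i₁ ∘ ⋯ ∘ f i_k`. -/
def wordMap {X : Type*} {ι : Type*} (f : ι → X → X) : List ι → X → X
  | [] => id
  | i :: I => f i ∘ wordMap f I

/-- The prefix word `x₁ ⋯ x_n` of an infinite word `x`. -/
def pre {ι : Type*} (x : ℕ → ι) (n : ℕ) : List ι := List.ofFn (fun j : Fin n => x j)

/-- `K` is the attractor of the IFS `f`: the (unique) nonempty compact set with
`K = ⋃ i, f i '' K`. -/
def IsAttractor {X : Type*} [MetricSpace X] {ι : Type*} (f : ι → X → X) (K : Set X) : Prop :=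
  K.Nonempty ∧ IsCompact K ∧ K = ⋃ i, f i '' K

/-- `g` is a bi-Lipschitz contraction. -/
def IsBiLipContraction {X : Type*} [MetricSpace X] (g : X → X) : Prop :=
  ∃ A B : ℝ, 0 < A ∧ B < 1 ∧ ∀ x y : X,
    A * dist x y ≤ dist (g x) (g y) ∧ dist (g x) (g y) ≤ B * dist x y

/-- `g` is a similitude of ratio `r`. -/
def IsSimilitude {X : Type*} [MetricSpace X] (g : X → X) (r : ℝ) : Prop :=
  ∀ x y : X, dist (g x) (g y) = r * dist x y

/-- The critical set `C_F = ⋃_{i ≠ j} f_i(K) ∩ f_j(K)`. -/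
def criticalSet {X : Type*} {ι : Type*} (f : ι → X → X) (K : Set X) : Set X :=
  ⋃ (i : ι) (j : ι) (_ : i ≠ j), (f i '' K) ∩ (f j '' K)

/-- The post-critical set `P_F = ⋃_{ω ∈ Σ^*} f_ω⁻¹(C_F) ∩ K`. -/
def postCriticalSet {X : Type*} {ι : Type*} (f : ι → X → X) (K : Set X) : Set X :=
  {p | p ∈ K ∧ ∃ I : List ι, I ≠ [] ∧ wordMap f I p ∈ criticalSet f K}

/-- `π` is the coding map of `(f, K)`: `{π x} = ⋂_k f_{x₁⋯x_k}(K)`. -/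
def IsCodingMap {X : Type*} {ι : Type*} (f : ι → X → X) (K : Set X)
    (π : (ℕ → ι) → X) : Prop :=
  ∀ x : ℕ → ι, (⋂ k : ℕ, wordMap f (pre x (k + 1)) '' K) = {π x}

/-- Single intersection condition: `f_i(K) ∩ f_j(K)` contains at most one point for `i ≠ j`. -/
def SIC {X : Type*} {ι : Type*} (f : ι → X → X) (K : Set X) : Prop :=
  ∀ i j : ι, i ≠ j → ((f i '' K) ∩ (f j '' K)).Subsingleton

/-- Angle separation condition with respect to a distance function `D`. -/
def ASCwrt {X : Type*} {ι : Type*} (f : ι → X → X) (K : Set X) (D : X → X → ℝ) : Prop :=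
  ∃ c : ℝ, 0 < c ∧ ∀ i j : ι, i ≠ j → ∀ z : X, (f i '' K) ∩ (f j '' K) = {z} →
    ∀ x ∈ f i '' K, ∀ y ∈ f j '' K, c * max (D x z) (D y z) ≤ D x y

/-- Angle separation condition. -/
def ASC {X : Type*} [MetricSpace X] {ι : Type*} (f : ι → X → X) (K : Set X) : Prop :=
  ASCwrt f K dist

/-- Lexicographic order on infinite words. -/
def lexLe {ι : Type*} [LinearOrder ι] (x y : ℕ → ι) : Prop :=
  x = y ∨ ∃ n : ℕ, (∀ k < n, x k = y k) ∧ x n < y n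

/-- `Σ_K`: the set of lowest codings, i.e. of words that are lexicographically least
among all words with the same image under the coding map `π`. -/
def lowestCodings {X : Type*} {ι : Type*} [LinearOrder ι] (π : (ℕ → ι) → X) :
    Set (ℕ → ι) :=
  {x | ∀ y : ℕ → ι, π y = π x → lexLe x y}

/-- `∂Σ_K`: the set of first letters of codings of post-critical points. -/
def bdryLetters {X : Type*} {ι : Type*} (f : ι → X → X) (K : Set X)
    (π : (ℕ → ι) → X) : Set ι :=
  {i | ∃ x : ℕ → ι, π x ∈ postCriticalSet f K ∧ x 0 = i}

/-- The contraction ratio `r_I = r_{i₁} ⋯ r_{i_k}` of a word. -/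
def rword {ι : Type*} (r : ι → ℝ) (I : List ι) : ℝ := (I.map r).prod

section Words

variable {X ι : Type*} {f : ι → X → X} {K : Set X} {π : (ℕ → ι) → X}

theorem length_pre (x : ℕ → ι) (n : ℕ) : (pre x n).length = n := by
  simp [pre]

theorem pre_add (x : ℕ → ι) (n m : ℕ) :
    pre x (n + m) = pre x n ++ pre (fun j => x (n + j)) m := by
  simp [pre, List.ofFn_add]

theorem pre_succ (x : ℕ → ι) (n : ℕ) : pre x (n + 1) = pre x n ++ [x n] := by
  rw [pre_add]
  simp [pre]

theorem pre_congr {x y : ℕ → ι} {n : ℕ} (h : ∀ k < n, x k = y k) : pre x n = pre y n := by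
  unfold pre
  congr 1
  funext j
  exact h j j.2

theorem wordMap_append (I J : List ι) : wordMap f (I ++ J) = wordMap f I ∘ wordMap f J := by
  induction I with
  | nil => rfl
  | cons i I ih => simp only [List.cons_append, wordMap, ih, Function.comp_assoc]

theorem lexLe_antisymm [LinearOrder ι] {x y : ℕ → ι} (hxy : lexLe x y) (hyx : lexLe y x) :
    x = y := by
  rcases hxy with h | ⟨n, hn, hlt⟩
  · exact h
  rcases hyx with h | ⟨m, hm, hlt'⟩
  · exact h.symm
  rcases lt_trichotomy n m with h | h | h
  · exact absurd (hm n h) hlt.ne'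
  · subst h
    exact absurd hlt hlt'.asymm
  · exact absurd (hn m h) hlt'.ne'

theorem eq_of_mem_lowestCodings [LinearOrder ι] {x y : ℕ → ι} (hx : x ∈ lowestCodings π)
    (hy : y ∈ lowestCodings π) (h : π x = π y) : x = y :=
  lexLe_antisymm (hx y h.symm) (hy x h)

theorem wordMap_image_subset (hmap : ∀ i, MapsTo (f i) K K) (I : List ι) :
    wordMap f I '' K ⊆ K := by
  induction I with
  | nil => simp [wordMap]
  | cons i I ih =>
    rw [wordMap, image_comp]
    exact (image_mono ih).trans (hmap i).image_subset

theorem wordMap_append_image_subset (hmap : ∀ i, MapsTo (f i) K K) (I J : List ι) :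
    wordMap f (I ++ J) '' K ⊆ wordMap f I '' K := by
  rw [wordMap_append, image_comp]
  exact image_mono (wordMap_image_subset hmap J)

theorem IsCodingMap.mem_cylinder (hπ : IsCodingMap f K π) (hmap : ∀ i, MapsTo (f i) K K)
    (x : ℕ → ι) (n : ℕ) : π x ∈ wordMap f (pre x n) '' K := by
  have h : π x ∈ ⋂ k : ℕ, wordMap f (pre x (k + 1)) '' K := by
    rw [hπ x]
    rfl
  have hn := mem_iInter.1 h n
  rw [pre_succ] at hn
  exact wordMap_append_image_subset hmap _ _ hn

theorem IsCodingMap.exists_coding (hπ : IsCodingMap f K π) (hsub : K ⊆ ⋃ i, f i '' K)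
    {p : X} (hp : p ∈ K) : ∃ x, π x = p := by
  have hstep : ∀ q : K, ∃ (i : ι) (r : K), f i r = q := fun q => by
    obtain ⟨i, r, hr, h⟩ := mem_iUnion.1 (hsub q.2)
    exact ⟨i, ⟨r, hr⟩, h⟩
  choose a s has using hstep
  let x : ℕ → ι := fun n => a (s^[n] ⟨p, hp⟩)
  have hx : ∀ n, wordMap f (pre x n) (s^[n] ⟨p, hp⟩ : K) = p := by
    intro n
    induction n with
    | zero => rfl
    | succ n ih =>
      rw [pre_succ, wordMap_append, Function.iterate_succ_apply']
      simpa [wordMap, x, has] using ih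
  have hmem : p ∈ ⋂ k : ℕ, wordMap f (pre x (k + 1)) '' K :=
    mem_iInter.2 fun k => ⟨_, (s^[k + 1] ⟨p, hp⟩).2, hx _⟩
  rw [hπ x] at hmem
  exact ⟨x, hmem.symm⟩

theorem finite_postCriticalSet (hπ : IsCodingMap f K π) (hsub : K ⊆ ⋃ i, f i '' K)
    (hpcf : (π ⁻¹' postCriticalSet f K).Finite) : (postCriticalSet f K).Finite := by
  refine (hpcf.image π).subset fun p hp => ?_
  obtain ⟨x, rfl⟩ := hπ.exists_coding hsub hp.1
  exact ⟨x, hp, rfl⟩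

end Words

section Estimates

variable {X ι : Type*} [MetricSpace X] {f : ι → X → X} {K : Set X} {π : (ℕ → ι) → X}

theorem pow_mul_dist_le_dist_wordMap {a : ℝ} (ha : 0 ≤ a)
    (hf : ∀ i x y, a * dist x y ≤ dist (f i x) (f i y)) (I : List ι) (x y : X) :
    a ^ I.length * dist x y ≤ dist (wordMap f I x) (wordMap f I y) := by
  induction I with
  | nil => simp [wordMap]
  | cons i I ih =>
    calc a ^ (I.length + 1) * dist x y = a * (a ^ I.length * dist x y) := by ring
      _ ≤ a * dist (wordMap f I x) (wordMap f I y) := by gcongr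
      _ ≤ _ := hf i _ _

theorem dist_wordMap_le_pow_mul_dist {b : ℝ} (hb : 0 ≤ b)
    (hf : ∀ i x y, dist (f i x) (f i y) ≤ b * dist x y) (I : List ι) (x y : X) :
    dist (wordMap f I x) (wordMap f I y) ≤ b ^ I.length * dist x y := by
  induction I with
  | nil => simp [wordMap]
  | cons i I ih =>
    calc dist (f i (wordMap f I x)) (f i (wordMap f I y))
        ≤ b * dist (wordMap f I x) (wordMap f I y) := hf i _ _
      _ ≤ b * (b ^ I.length * dist x y) := by gcongr
      _ = b ^ (I.length + 1) * dist x y := by ring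

theorem wordMap_injective {a : ℝ} (ha : 0 < a)
    (hf : ∀ i x y, a * dist x y ≤ dist (f i x) (f i y)) (I : List ι) :
    Function.Injective (wordMap f I) := by
  intro x y hxy
  have h := pow_mul_dist_le_dist_wordMap ha.le hf I x y
  rw [hxy, dist_self] at h
  exact dist_le_zero.1 (nonpos_of_mul_nonpos_right h (pow_pos ha _))

/-- A finite family of disjoint pairs of compact sets is uniformly separated. -/
theorem exists_pos_forall_le_dist_of_disjoint {κ : Type*} [Finite κ] (S T : κ → Set X)
    (hS : ∀ k, IsCompact (S k)) (hT : ∀ k, IsCompact (T k)) :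
    ∃ δ : ℝ, 0 < δ ∧ ∀ k, Disjoint (S k) (T k) → ∀ s ∈ S k, ∀ t ∈ T k, δ ≤ dist s t := by
  have h : ∀ k, ∃ δ : ℝ, 0 < δ ∧
      (Disjoint (S k) (T k) → ∀ s ∈ S k, ∀ t ∈ T k, δ ≤ dist s t) := by
    intro k
    by_cases hd : Disjoint (S k) (T k)
    · obtain ⟨r, hr, h⟩ := exists_pos_forall_lt_edist (hS k) (hT k).isClosed hd
      refine ⟨r, hr, fun _ s hs t ht => ?_⟩
      have := h s hs t ht
      rw [edist_nndist, ENNReal.coe_lt_coe] at this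
      exact_mod_cast this.le
    · exact ⟨1, one_pos, fun h => absurd h hd⟩
  choose δ hδ hsep using h
  cases isEmpty_or_nonempty κ
  · exact ⟨1, one_pos, isEmptyElim⟩
  · obtain ⟨k₀, hk₀⟩ := Finite.exists_min δ
    exact ⟨δ k₀, hδ k₀, fun k hd s hs t ht => (hk₀ k).trans (hsep k hd s hs t ht)⟩

theorem dist_le_of_cylinders_meet (hK : IsCompact K) {b : ℝ} (hb : 0 ≤ b)
    (hf : ∀ i x y, dist (f i x) (f i y) ≤ b * dist x y) {I J : List ι}
    (hlen : I.length = J.length) (hmeet : (wordMap f I '' K ∩ wordMap f J '' K).Nonempty)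
    {p q : X} (hp : p ∈ wordMap f I '' K) (hq : q ∈ wordMap f J '' K) :
    dist p q ≤ 2 * diam K * b ^ I.length := by
  obtain ⟨z, ⟨u, hu, rfl⟩, ⟨v, hv, hvu⟩⟩ := hmeet
  obtain ⟨p, hp, rfl⟩ := hp
  obtain ⟨q, hq, rfl⟩ := hq
  have h₁ := (dist_wordMap_le_pow_mul_dist hb hf I p u).trans
    (mul_le_mul_of_nonneg_left (dist_le_diam_of_mem hK.isBounded hp hu) (by positivity))
  have h₂ := (dist_wordMap_le_pow_mul_dist hb hf J v q).trans
    (mul_le_mul_of_nonneg_left (dist_le_diam_of_mem hK.isBounded hv hq) (by positivity))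
  rw [hvu, ← hlen] at h₂
  linarith [dist_triangle (wordMap f I p) (wordMap f I u) (wordMap f J q)]

/-- A critical point that leaves the cylinder of `x` exactly at level `m + 1` stays at
distance at least a multiple of `a ^ m` from the cylinder of level `m + 1`. -/
theorem mul_pow_le_dist_of_notMem_cylinder {a δ : ℝ} (ha : 0 < a)
    (hf : ∀ i x y, a * dist x y ≤ dist (f i x) (f i y))
    (hδ : ∀ p ∈ postCriticalSet f K, ∀ i, p ∉ f i '' K → ∀ q ∈ f i '' K, δ ≤ dist q p)
    {x : ℕ → ι} {m : ℕ} (hm : m ≠ 0) {z : X} (hz : z ∈ criticalSet f K)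
    (hzm : z ∈ wordMap f (pre x m) '' K) (hzm' : z ∉ wordMap f (pre x (m + 1)) '' K)
    {p : X} (hp : p ∈ wordMap f (pre x (m + 1)) '' K) : δ * a ^ m ≤ dist p z := by
  rw [pre_succ, wordMap_append, image_comp] at hp hzm'
  obtain ⟨w, hw, rfl⟩ := hzm
  obtain ⟨q, hq, rfl⟩ := hp
  have hw' : w ∉ f (x m) '' K := fun h => hzm' (mem_image_of_mem _ h)
  have hpc : w ∈ postCriticalSet f K := by
    refine ⟨hw, pre x m, fun h => hm ?_, hz⟩
    rw [← length_pre x m, h, List.length_nil]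
  have h := pow_mul_dist_le_dist_wordMap ha.le hf (pre x m) q w
  rw [length_pre] at h
  calc δ * a ^ m = a ^ m * δ := mul_comm _ _
    _ ≤ a ^ m * dist q w := by gcongr; exact hδ w hpc _ hw' q hq
    _ ≤ _ := h

/-- The lower distance estimate for words that differ at the first letter. -/
theorem exists_lower_bound_of_head_ne [Finite ι] (hcont : ∀ i, Continuous (f i))
    (hK : IsCompact K) (hmap : ∀ i, MapsTo (f i) K K) (hfin : (postCriticalSet f K).Finite)
    (hSIC : SIC f K) (hASC : ASC f K) {a : ℝ} (ha : 0 < a)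
    (hf : ∀ i x y, a * dist x y ≤ dist (f i x) (f i y)) :
    ∃ c : ℝ, 0 < c ∧ ∀ (x y : ℕ → ι) (m : ℕ), x 0 ≠ y 0 →
      wordMap f (pre x (m + 1)) '' K ∩ wordMap f (pre y (m + 1)) '' K = ∅ →
      (m ≠ 0 → (wordMap f (pre x m) '' K ∩ wordMap f (pre y m) '' K).Nonempty) →
      ∀ p ∈ wordMap f (pre x (m + 1)) '' K, ∀ q ∈ wordMap f (pre y (m + 1)) '' K,
        c * a ^ m ≤ dist p q := by
  have := hfin.to_subtype
  obtain ⟨δ, hδ, hδsep⟩ := exists_pos_forall_le_dist_of_disjoint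
    (fun k : ι × ι => f k.1 '' K) (fun k => f k.2 '' K)
    (fun k => hK.image (hcont _)) (fun k => hK.image (hcont _))
  obtain ⟨ε, hε, hεsep⟩ := exists_pos_forall_le_dist_of_disjoint
    (fun k : postCriticalSet f K × ι => f k.2 '' K) (fun k => {(k.1 : X)})
    (fun k => hK.image (hcont _)) (fun k => isCompact_singleton)
  have hε' : ∀ p ∈ postCriticalSet f K, ∀ i, p ∉ f i '' K → ∀ q ∈ f i '' K, ε ≤ dist q p :=
    fun p hp i hpi q hq =>
      hεsep (⟨p, hp⟩, i) (disjoint_singleton_right.2 hpi) q hq p rfl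
  obtain ⟨c, hc, hASC⟩ := hASC
  refine ⟨min δ (c * ε), by positivity, fun x y m hne hdisj hmeet p hp q hq => ?_⟩
  have hhead : ∀ (x : ℕ → ι) (k : ℕ), k ≠ 0 → wordMap f (pre x k) '' K ⊆ f (x 0) '' K := by
    intro x k hk
    obtain ⟨k, rfl⟩ := Nat.exists_eq_succ_of_ne_zero hk
    rw [Nat.succ_eq_add_one, add_comm, pre_add]
    exact wordMap_append_image_subset hmap _ _
  have hp₀ := hhead x _ m.succ_ne_zero hp
  have hq₀ := hhead y _ m.succ_ne_zero hq
  rcases eq_or_ne m 0 with rfl | hm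
  · have h : Disjoint (f (x 0) '' K) (f (y 0) '' K) := disjoint_iff_inter_eq_empty.2 hdisj
    simpa using Or.inl (hδsep (x 0, y 0) h p hp₀ q hq₀)
  · obtain ⟨z, hzx, hzy⟩ := hmeet hm
    have hz : f (x 0) '' K ∩ f (y 0) '' K = {z} :=
      (hSIC _ _ hne).eq_singleton_of_mem ⟨hhead x m hm hzx, hhead y m hm hzy⟩
    have hcrit : z ∈ criticalSet f K :=
      mem_iUnion₂.2 ⟨x 0, y 0, mem_iUnion.2 ⟨hne, hz.symm ▸ mem_singleton z⟩⟩
    have hmax : ε * a ^ m ≤ max (dist p z) (dist q z) := by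
      by_cases h : z ∈ wordMap f (pre x (m + 1)) '' K
      · have h' : z ∉ wordMap f (pre y (m + 1)) '' K := fun h' =>
          (hdisj.subset ⟨h, h'⟩ : z ∈ (∅ : Set X))
        exact le_max_of_le_right
          (mul_pow_le_dist_of_notMem_cylinder ha hf hε' hm hcrit hzy h' hq)
      · exact le_max_of_le_left
          (mul_pow_le_dist_of_notMem_cylinder ha hf hε' hm hcrit hzx h hp)
    calc min δ (c * ε) * a ^ m ≤ c * ε * a ^ m := by gcongr; exact min_le_right _ _
      _ = c * (ε * a ^ m) := by ring
      _ ≤ c * max (dist p z) (dist q z) := by gcongr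
      _ ≤ dist p q := hASC _ _ hne z hz p hp₀ q hq₀

/-- The lower distance estimate at the first level where the cylinders are disjoint. -/
theorem exists_lower_bound [Finite ι] (hcont : ∀ i, Continuous (f i)) (hK : IsCompact K)
    (hne : K.Nonempty) (hmap : ∀ i, MapsTo (f i) K K) (hfin : (postCriticalSet f K).Finite)
    (hSIC : SIC f K) (hASC : ASC f K) {a : ℝ} (ha : 0 < a) (ha1 : a ≤ 1)
    (hf : ∀ i x y, a * dist x y ≤ dist (f i x) (f i y)) :
    ∃ c : ℝ, 0 < c ∧ ∀ (x y : ℕ → ι) (n : ℕ),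
      IsLeast {m : ℕ | 0 < m ∧
        wordMap f (pre x m) '' K ∩ wordMap f (pre y m) '' K = ∅} n →
      ∀ p ∈ wordMap f (pre x n) '' K, ∀ q ∈ wordMap f (pre y n) '' K,
        c * a ^ n ≤ dist p q := by
  classical
  obtain ⟨c, hc, hlow⟩ :=
    exists_lower_bound_of_head_ne hcont hK hmap hfin hSIC hASC ha hf
  refine ⟨c, hc, fun x y n hn p hp q hq => ?_⟩
  have hdiff : ∃ k, x k ≠ y k := by
    by_contra! h
    have h' := hn.1.2
    rw [funext h, inter_self] at h'
    exact (hne.image _).ne_empty h'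
  set k := Nat.find hdiff
  have hpre : pre x k = pre y k := pre_congr fun j hj => not_not.1 (Nat.find_min hdiff hj)
  have hkn : k < n := by
    by_contra! h
    have h' := hn.1.2
    rw [pre_congr fun j hj => not_not.1 (Nat.find_min hdiff (hj.trans_le h)), inter_self] at h'
    exact (hne.image _).ne_empty h'
  obtain ⟨m, rfl⟩ : ∃ m, n = k + (m + 1) := ⟨n - k - 1, by omega⟩
  have hinj := wordMap_injective ha hf (pre x k)
  have hcyl : ∀ j, wordMap f (pre x (k + j)) '' K ∩ wordMap f (pre y (k + j)) '' K =
      wordMap f (pre x k) '' (wordMap f (pre (fun i => x (k + i)) j) '' K ∩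
        wordMap f (pre (fun i => y (k + i)) j) '' K) := by
    intro j
    rw [pre_add x, pre_add y, ← hpre, wordMap_append, wordMap_append, image_comp, image_comp,
      image_inter hinj]
  have hdisj := hn.1.2
  rw [hcyl, image_eq_empty] at hdisj
  have hmeet : m ≠ 0 → (wordMap f (pre (fun i => x (k + i)) m) '' K ∩
      wordMap f (pre (fun i => y (k + i)) m) '' K).Nonempty := by
    intro hm
    rw [nonempty_iff_ne_empty]
    intro h
    have hle : k + (m + 1) ≤ k + m := hn.2 ⟨by omega, by rw [hcyl, h, image_empty]⟩
    omega
  rw [pre_add, wordMap_append, image_comp] at hp hq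
  obtain ⟨p, hp, rfl⟩ := hp
  obtain ⟨q, hq, rfl⟩ := hq
  have h := hlow _ _ m (Nat.find_spec hdiff) hdisj hmeet p hp q hq
  have hscale := pow_mul_dist_le_dist_wordMap ha.le hf (pre x k) p q
  rw [length_pre] at hscale
  rw [← hpre]
  calc c * a ^ (k + (m + 1)) = a ^ k * (c * a ^ m) * a := by ring
    _ ≤ a ^ k * (c * a ^ m) := mul_le_of_le_one_right (by positivity) ha1
    _ ≤ a ^ k * dist p q := by gcongr
    _ ≤ _ := hscale

/-- Words with different images have eventually disjoint cylinders. -/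
theorem exists_cylinders_disjoint (hK : IsCompact K) {b : ℝ} (hb : 0 ≤ b) (hb1 : b < 1)
    (hf : ∀ i x y, dist (f i x) (f i y) ≤ b * dist x y) (hmap : ∀ i, MapsTo (f i) K K)
    (hπ : IsCodingMap f K π) {x y : ℕ → ι} (hxy : π x ≠ π y) :
    ∃ m, 0 < m ∧ wordMap f (pre x m) '' K ∩ wordMap f (pre y m) '' K = ∅ := by
  by_contra! h
  have hlim : Filter.Tendsto (fun n : ℕ => 2 * diam K * b ^ n) Filter.atTop (nhds 0) := by
    simpa using (tendsto_pow_atTop_nhds_zero_of_lt_one hb hb1).const_mul (2 * diam K)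
  refine hxy (dist_le_zero.1 (ge_of_tendsto hlim ?_))
  filter_upwards [Filter.eventually_gt_atTop 0] with n hn
  simpa [length_pre] using dist_le_of_cylinders_meet hK hb hf
    (by simp [length_pre]) (h n hn)
    (hπ.mem_cylinder hmap x n) (hπ.mem_cylinder hmap y n)

theorem dist_le_of_isLeast (hK : IsCompact K) (hne : K.Nonempty) {b : ℝ} (hb : 0 ≤ b)
    (hf : ∀ i x y, dist (f i x) (f i y) ≤ b * dist x y) (hmap : ∀ i, MapsTo (f i) K K)
    (hπ : IsCodingMap f K π) {x y : ℕ → ι} {n : ℕ}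
    (hn : IsLeast {m : ℕ | 0 < m ∧
      wordMap f (pre x m) '' K ∩ wordMap f (pre y m) '' K = ∅} n) :
    dist (π x) (π y) ≤ 2 * diam K * b ^ (n - 1) := by
  have hmeet : (wordMap f (pre x (n - 1)) '' K ∩ wordMap f (pre y (n - 1)) '' K).Nonempty := by
    rcases Nat.eq_zero_or_pos (n - 1) with h | h
    · simpa [h, pre, wordMap] using hne
    · rw [nonempty_iff_ne_empty]
      intro he
      have := hn.2 ⟨h, he⟩
      have := hn.1.1
      omega
  simpa [length_pre] using dist_le_of_cylinders_meet hK hb hf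
    (by simp [length_pre]) hmeet
    (hπ.mem_cylinder hmap x _) (hπ.mem_cylinder hmap y _)

end Estimates

/-- **Lemma (surviving-time distance estimate).**
For a p.c.f. IFS of bi-Lipschitz contractions satisfying the SIC and the ASC, with lower
and upper Lipschitz constants `A i ≤ B i` and `A⋆ = min_i A i`, `B⋆ = max_i B i`, there
are constants `c₁, c₂ > 0` such that for distinct lowest codings `x ≠ y`, letting `n` be
the least positive integer with `f_{x₁⋯x_n}(K) ∩ f_{y₁⋯y_n}(K) = ∅` (such `n` exists),
`c₁ (A⋆)ⁿ ≤ d(π x, π y) ≤ c₂ (B⋆)ⁿ`. -/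
theorem surviving_time_distance_estimate
    {X : Type*} [MetricSpace X] [CompleteSpace X]
    {N : ℕ} (f : Fin N → X → X) (K : Set X) (π : (ℕ → Fin N) → X)
    (A B : Fin N → ℝ)
    (hAB : ∀ i, 0 < A i ∧ A i ≤ B i ∧ B i < 1)
    (hbil : ∀ i, ∀ x y : X,
      A i * dist x y ≤ dist (f i x) (f i y) ∧ dist (f i x) (f i y) ≤ B i * dist x y)
    (hK : IsAttractor f K) (hπ : IsCodingMap f K π)
    (hpcf : (π ⁻¹' postCriticalSet f K).Finite)
    (hSIC : SIC f K) (hASC : ASC f K)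
    (Astar Bstar : ℝ)
    (hAstar : IsLeast (Set.range A) Astar) (hBstar : IsGreatest (Set.range B) Bstar) :
    ∃ c₁ c₂ : ℝ, 0 < c₁ ∧ 0 < c₂ ∧
      ∀ x ∈ lowestCodings π, ∀ y ∈ lowestCodings π, x ≠ y →
        ∃ n : ℕ, IsLeast {m : ℕ | 0 < m ∧
            (wordMap f (pre x m) '' K) ∩ (wordMap f (pre y m) '' K) = ∅} n ∧
          c₁ * Astar ^ n ≤ dist (π x) (π y) ∧ dist (π x) (π y) ≤ c₂ * Bstar ^ n := by
  obtain ⟨⟨i₀, rfl⟩, hAmin⟩ := hAstar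
  obtain ⟨⟨j₀, rfl⟩, hBmax⟩ := hBstar
  obtain ⟨hne, hcomp, hinv⟩ := hK
  have ha : 0 < A i₀ := (hAB i₀).1
  have ha1 : A i₀ ≤ 1 := (hAB i₀).2.1.trans (hAB i₀).2.2.le
  have hb : 0 < B j₀ := (hAB j₀).1.trans_le (hAB j₀).2.1
  have hlow : ∀ i x y, A i₀ * dist x y ≤ dist (f i x) (f i y) := fun i x y =>
    (mul_le_mul_of_nonneg_right (hAmin ⟨i, rfl⟩) dist_nonneg).trans (hbil i x y).1
  have hup : ∀ i x y, dist (f i x) (f i y) ≤ B j₀ * dist x y := fun i x y =>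
    (hbil i x y).2.trans (mul_le_mul_of_nonneg_right (hBmax ⟨i, rfl⟩) dist_nonneg)
  have hcont : ∀ i, Continuous (f i) := fun i =>
    (LipschitzWith.of_dist_le_mul (K := ⟨B j₀, hb.le⟩) (hup i)).continuous
  have hmap : ∀ i, MapsTo (f i) K K := fun i p hp => by
    rw [hinv]
    exact mem_iUnion.2 ⟨i, p, hp, rfl⟩
  obtain ⟨c, hc, hc_le⟩ := exists_lower_bound hcont hcomp hne hmap
    (finite_postCriticalSet hπ hinv.subset hpcf) hSIC hASC ha ha1 hlow
  refine ⟨c, (2 * diam K + 1) / B j₀, hc, by positivity, fun x hx y hy hxy => ?_⟩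
  have hex := exists_cylinders_disjoint hcomp hb.le (hAB j₀).2.2 hup hmap hπ
    (fun h => hxy (eq_of_mem_lowestCodings hx hy h))
  classical
  have hleast : IsLeast {m : ℕ | 0 < m ∧
      (wordMap f (pre x m) '' K) ∩ (wordMap f (pre y m) '' K) = ∅} (Nat.find hex) :=
    ⟨Nat.find_spec hex, fun m hm => Nat.find_min' hex hm⟩
  refine ⟨_, hleast, hc_le x y _ hleast _ (hπ.mem_cylinder hmap x _) _
    (hπ.mem_cylinder hmap y _), ?_⟩
  refine (dist_le_of_isLeast hcomp hne hb.le hup hmap hπ hleast).trans ?_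
  obtain ⟨m, hm⟩ := Nat.exists_eq_succ_of_ne_zero hleast.1.1.ne'
  rw [hm, Nat.succ_sub_one, pow_succ]
  calc 2 * diam K * B j₀ ^ m ≤ (2 * diam K + 1) * B j₀ ^ m := by gcongr; linarith
    _ = (2 * diam K + 1) / B j₀ * (B j₀ ^ m * B j₀) := by field_simp
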